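/- arXiv:2008.00392 — 9 statements merged into one kernel-verified Lean document; each statement's English description precedes it below -/
import Mathlib

section
/- For every k > a the point c(k) satisfies the identity k − a = c(k) + c(k)^{(1−α)/(1−β)}. Consequently c(k) → +∞ as k → +∞, and lim_{k→∞} c(k) / k^{(1−β)/(1−α)} = 1. -/
open Filter Topology in
/-- If `k - a = c k + (c k) ^ p` with `c k > 0` and `p > 0`, then `c k` tends to infinity. -/
theorem tendsto_atTop_of_eq_add_rpow {p a : ℝ} (hp : 0 < p) {c : ℝ → ℝ}
    (hpos : ∀ k, a < k → 0 < c k) (h : ∀ k, a < k → k - a = c k + c k ^ p) :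
    Tendsto c atTop atTop := by
  refine tendsto_atTop.2 fun M => ?_
  filter_upwards [eventually_gt_atTop a, eventually_gt_atTop (a + M + M ^ p)] with k hk hkM
  by_contra! hlt
  have := Real.rpow_le_rpow (hpos k hk).le hlt.le hp.le
  linarith [h k hk]

open Filter Topology in
/-- If `k - a = c k + (c k) ^ p` with `c k > 0` and `p > 1`, then `c k` is asymptotic to
`k ^ (1 / p)`. -/
theorem tendsto_div_rpow_of_eq_add_rpow {p a : ℝ} (hp : 1 < p) {c : ℝ → ℝ}
    (hpos : ∀ k, a < k → 0 < c k) (h : ∀ k, a < k → k - a = c k + c k ^ p) :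
    Tendsto (fun k => c k / k ^ p⁻¹) atTop (𝓝 1) := by
  have hp0 : 0 < p := by linarith
  have hc := tendsto_atTop_of_eq_add_rpow hp0 hpos h
  have hlim : Tendsto (fun x : ℝ => (1 + a * x ^ (-p) + x ^ (-(p - 1))) ^ (-p⁻¹)) atTop (𝓝 1) := by
    have h1 := (tendsto_rpow_neg_atTop hp0).const_mul a
    have h2 := tendsto_rpow_neg_atTop (sub_pos.2 hp)
    have h3 := ((h1.const_add 1).add h2).rpow_const (p := -p⁻¹) (Or.inl (by norm_num))
    simpa using h3
  refine (hlim.comp hc).congr' ?_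
  filter_upwards [eventually_gt_atTop a, eventually_gt_atTop 0] with k hk hk0
  have hck := hpos k hk
  have hcp := Real.rpow_pos_of_pos hck p
  have key : 1 + a * c k ^ (-p) + c k ^ (-(p - 1)) = k / c k ^ p := by
    rw [neg_sub, Real.rpow_sub hck, Real.rpow_one, Real.rpow_neg hck.le]
    field_simp
    linarith [h k hk]
  rw [Function.comp_apply, key, Real.rpow_neg (by positivity), Real.div_rpow hk0.le hcp.le,
    Real.rpow_rpow_inv hck.le hp0.ne', inv_div]

/-- For `k > a`, the first-order-condition point `c(k)` (the unique solution in
`(0, k-a)` of `c^(α-1) = (k-c-a)^(β-1)`) satisfies `k - a = c(k) + c(k)^((1-α)/(1-β))`;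
consequently `c(k) → ∞` as `k → ∞` and `c(k)/k^((1-β)/(1-α)) → 1`. -/
theorem stmt_2 (α β a : ℝ) (hα : 0 < α) (hαβ : α < β) (hβ : β < 1) (ha : 0 < a)
    (c : ℝ → ℝ)
    (hc : ∀ k, a < k →
      c k ∈ Set.Ioo 0 (k - a) ∧ (c k) ^ (α - 1) = (k - c k - a) ^ (β - 1)) :
    (∀ k, a < k → k - a = c k + (c k) ^ ((1 - α) / (1 - β))) ∧
    Filter.Tendsto c Filter.atTop Filter.atTop ∧
    Filter.Tendsto (fun k => c k / k ^ ((1 - β) / (1 - α))) Filter.atTop (nhds 1) := by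
  have hpos : ∀ k, a < k → 0 < c k := fun k hk => (hc k hk).1.1
  have hp : 1 < (1 - α) / (1 - β) := by
    rw [one_lt_div (by linarith)]
    linarith
  have hid : ∀ k, a < k → k - a = c k + (c k) ^ ((1 - α) / (1 - β)) := by
    intro k hk
    obtain ⟨⟨h0, h1⟩, h2⟩ := hc k hk
    have hexp : (1 - α) / (1 - β) = (α - 1) * (β - 1)⁻¹ := by
      rw [← div_eq_mul_inv, ← neg_sub α, ← neg_sub β, neg_div_neg_eq]
    rw [hexp, Real.rpow_mul h0.le, h2, Real.rpow_rpow_inv (by linarith) (by linarith)]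
    ring
  refine ⟨hid, tendsto_atTop_of_eq_add_rpow (by linarith) hpos hid, ?_⟩
  rw [← inv_div (1 - α)]
  exact tendsto_div_rpow_of_eq_add_rpow hp hpos hid
end

section
/- For every k > a, if c(k) ≥ 1 then c(k) ≤ (k − a)/2. -/
/-- For `k > a`, if the first-order-condition point `c(k)` (the unique solution in
`(0, k-a)` of `c^(α-1) = (k-c-a)^(β-1)`) satisfies `c(k) ≥ 1`, then `c(k) ≤ (k-a)/2`. -/
theorem stmt_3 (α β a : ℝ) (hα : 0 < α) (hαβ : α < β) (hβ : β < 1) (ha : 0 < a)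
    (c : ℝ → ℝ)
    (hc : ∀ k, a < k →
      c k ∈ Set.Ioo 0 (k - a) ∧ (c k) ^ (α - 1) = (k - c k - a) ^ (β - 1)) :
    ∀ k, a < k → 1 ≤ c k → c k ≤ (k - a) / 2 := by
  intro k hk h1
  obtain ⟨⟨_, hck⟩, heq⟩ := hc k hk
  by_contra! h
  have hlt : (c k) ^ (β - 1) < (k - c k - a) ^ (β - 1) :=
    Real.rpow_lt_rpow_of_neg (by linarith) (by linarith) (by linarith)
  have hle : (c k) ^ (α - 1) ≤ (c k) ^ (β - 1) :=
    Real.rpow_le_rpow_of_exponent_le h1 (by linarith)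
  linarith
end

section
/- One has lim_{k→a⁺} c(k) = 0, lim_{k→a⁺} ( F_k(c(k)) − k^α/α ) = −a^α/α (which is negative), and lim_{k→∞} ( F_k(c(k)) − k^α/α ) = +∞. In particular, the interior optimum F_k(c(k)) is strictly smaller than the boundary value k^α/α for k sufficiently close to a, and strictly larger for all sufficiently large k. -/
/-- The inner (pre-utility) value of splitting total consumption `k` into basic
consumption `c` and luxury consumption `k - c`:  `F k c = c^α/α + ((k-c-a)⁺)^β/β`. -/
noncomputable def F (α β a k c : ℝ) : ℝ :=
  c ^ α / α + (max (k - c - a) 0) ^ β / β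

open Filter Topology

/-- If `c^(α-1) = y^(β-1)` with `α < β < 1` and `c + y ≥ 2`, then `c ≤ y`. -/
theorem le_of_rpow_sub_one_eq {α β c y : ℝ} (hαβ : α < β) (hβ : β < 1) (hy : 0 < y)
    (h : c ^ (α - 1) = y ^ (β - 1)) (hcy : 2 ≤ c + y) : c ≤ y := by
  by_contra! hlt
  have hc1 : 1 < c := by linarith
  have h1 : c ^ (α - 1) < c ^ (β - 1) := Real.rpow_lt_rpow_of_exponent_lt hc1 (by linarith)
  have h2 : c ^ (β - 1) < y ^ (β - 1) := Real.rpow_lt_rpow_of_neg hy hlt (by linarith)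
  linarith

/-- A larger power, even of a rescaled argument, eventually dominates a smaller one. -/
theorem tendsto_div_rpow_div_sub_rpow_div_atTop {α β r : ℝ} (hα : 0 < α) (hαβ : α < β)
    (hr : 0 < r) :
    Tendsto (fun k : ℝ => (k / r) ^ β / β - k ^ α / α) atTop atTop := by
  have hβ : 0 < β := hα.trans hαβ
  have hC : 0 < 1 / (r ^ β * β) := by positivity
  have h : Tendsto (fun k : ℝ => k ^ α * (k ^ (β - α) * (1 / (r ^ β * β)) + -(1 / α)))
      atTop atTop :=
    (tendsto_rpow_atTop hα).atTop_mul_atTop₀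
      (tendsto_atTop_add_const_right _ _
        ((tendsto_rpow_atTop (sub_pos.2 hαβ)).atTop_mul_const hC))
  refine h.congr' ?_
  filter_upwards [eventually_gt_atTop 0] with k hk
  have hsplit : k ^ β = k ^ α * k ^ (β - α) := by
    rw [← Real.rpow_add hk]
    congr 1
    ring
  have hrβ : r ^ β ≠ 0 := (Real.rpow_pos_of_pos hr β).ne'
  rw [Real.div_rpow hk.le hr.le, hsplit]
  field_simp
  ring

/-- `c(k) → 0` as `k → a⁺`; `F_k(c(k)) - k^α/α → -a^α/α < 0` as `k → a⁺`;
`F_k(c(k)) - k^α/α → +∞` as `k → ∞`.  In particular the interior optimum is strictly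
below the boundary value for `k` close to `a` and strictly above it for large `k`. -/
theorem stmt_4 (α β a : ℝ) (hα : 0 < α) (hαβ : α < β) (hβ : β < 1) (ha : 0 < a)
    (c : ℝ → ℝ)
    (hc : ∀ k, a < k →
      c k ∈ Set.Ioo 0 (k - a) ∧ (c k) ^ (α - 1) = (k - c k - a) ^ (β - 1)) :
    Filter.Tendsto c (nhdsWithin a (Set.Ioi a)) (nhds 0) ∧
    Filter.Tendsto (fun k => F α β a k (c k) - k ^ α / α)
      (nhdsWithin a (Set.Ioi a)) (nhds (-(a ^ α / α))) ∧
    -(a ^ α / α) < 0 ∧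
    Filter.Tendsto (fun k => F α β a k (c k) - k ^ α / α) Filter.atTop Filter.atTop ∧
    (∃ δ > (0:ℝ), ∀ k, a < k → k < a + δ → F α β a k (c k) < k ^ α / α) ∧
    (∃ M : ℝ, ∀ k, M ≤ k → k ^ α / α < F α β a k (c k)) := by
  have hβ0 : 0 < β := hα.trans hαβ
  have hneg : -(a ^ α / α) < 0 := neg_neg_of_pos (by positivity)
  have hid : Tendsto (fun k : ℝ => k) (𝓝[>] a) (𝓝 a) := nhdsWithin_le_nhds
  have hc0 : Tendsto c (𝓝[>] a) (𝓝 0) := by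
    have hsub : Tendsto (fun k : ℝ => k - a) (𝓝[>] a) (𝓝 0) := by
      simpa using hid.sub_const a
    refine tendsto_of_tendsto_of_tendsto_of_le_of_le' tendsto_const_nhds hsub ?_ ?_
    · filter_upwards [self_mem_nhdsWithin] with k hk using (hc k hk).1.1.le
    · filter_upwards [self_mem_nhdsWithin] with k hk using (hc k hk).1.2.le
  have hlim : Tendsto (fun k => F α β a k (c k) - k ^ α / α) (𝓝[>] a) (𝓝 (-(a ^ α / α))) := by
    have hy : Tendsto (fun k => max (k - c k - a) 0) (𝓝[>] a) (𝓝 0) := by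
      simpa using ((hid.sub hc0).sub_const a).max (tendsto_const_nhds (x := (0 : ℝ)))
    have h := (((hc0.rpow_const (Or.inr hα.le)).div_const α).add
      ((hy.rpow_const (Or.inr hβ0.le)).div_const β)).sub
      ((hid.rpow_const (p := α) (Or.inr hα.le)).div_const α)
    simpa [F, Real.zero_rpow hα.ne', Real.zero_rpow hβ0.ne'] using h
  have htop : Tendsto (fun k => F α β a k (c k) - k ^ α / α) atTop atTop := by
    refine tendsto_atTop_mono' _ ?_
      (tendsto_div_rpow_div_sub_rpow_div_atTop hα hαβ (r := 4) (by norm_num))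
    filter_upwards [eventually_ge_atTop (2 * a + 2)] with k hk
    obtain ⟨⟨hpos, hlt⟩, heq⟩ := hc k (by linarith)
    have hle : c k ≤ k - c k - a :=
      le_of_rpow_sub_one_eq hαβ hβ (by linarith) heq (by linarith)
    have hpow : (k / 4) ^ β ≤ (max (k - c k - a) 0) ^ β :=
      Real.rpow_le_rpow (by linarith) (le_max_of_le_left (by linarith)) hβ0.le
    have hdiv : (k / 4) ^ β / β ≤ (max (k - c k - a) 0) ^ β / β := by gcongr
    have hcα : 0 ≤ c k ^ α / α := by positivity
    unfold F
    linarith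
  refine ⟨hc0, hlim, hneg, htop, ?_, ?_⟩
  · obtain ⟨u, hu, hsub⟩ :=
      mem_nhdsGT_iff_exists_Ioo_subset.1 (hlim.eventually_lt_const hneg)
    refine ⟨u - a, sub_pos.2 hu, fun k hk hku => ?_⟩
    exact sub_neg.1 (hsub ⟨hk, by linarith⟩)
  · obtain ⟨M, hM⟩ := eventually_atTop.1 (htop.eventually_gt_atTop 0)
    exact ⟨M, fun k hk => sub_pos.1 (hM k hk)⟩
end

section
/- There exists a unique k₀ > a such that F_{k₀}(c(k₀)) = k₀^α/α; moreover F_k(c(k)) < k^α/α for all k with a < k < k₀ and F_k(c(k)) > k^α/α for all k > k₀. Consequently, for 0 < k < k₀ the maximum of F_k over [0,k] equals k^α/α and is attained only at c = k, while for k > k₀ the maximum of F_k over [0,k] equals F_k(c(k)) and is attained only at c = c(k). -/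
theorem Real.rpow_div_lt_tangent {p u x : ℝ} (hp : 0 < p) (hp1 : p < 1) (hu : 0 < u)
    (hx : 0 ≤ x) (hxu : x ≠ u) :
    x ^ p / p < u ^ p / p + u ^ (p - 1) * (x - u) := by
  have hs : -1 ≤ x / u - 1 := by linarith [div_nonneg hx hu.le]
  have hs0 : x / u - 1 ≠ 0 := by
    intro h
    exact hxu ((div_eq_one_iff_eq hu.ne').1 (by linarith))
  have h := rpow_one_add_lt_one_add_mul_self hs hs0 hp hp1
  rw [show 1 + (x / u - 1) = x / u by ring, div_rpow hx hu.le,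
    div_lt_iff₀ (rpow_pos_of_pos hu p)] at h
  rw [rpow_sub_one hu.ne', div_lt_iff₀ hp]
  refine h.trans_eq ?_
  field_simp

theorem Real.rpow_div_le_tangent {p u x : ℝ} (hp : 0 < p) (hp1 : p < 1) (hu : 0 < u)
    (hx : 0 ≤ x) :
    x ^ p / p ≤ u ^ p / p + u ^ (p - 1) * (x - u) := by
  rcases eq_or_ne x u with rfl | hxu
  · simp
  · exact (rpow_div_lt_tangent hp hp1 hu hx hxu).le

theorem StrictConcaveOn.add_lt_add_of_translate {s : Set ℝ} {f : ℝ → ℝ}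
    (hf : StrictConcaveOn ℝ s f) {x y d : ℝ} (hx : x ∈ s) (hyd : y + d ∈ s) (hxy : x < y)
    (hd : 0 < d) : f x + f (y + d) < f (x + d) + f y := by
  have hne : x ≠ y + d := by linarith
  have hpos : 0 < y - x + d := by linarith
  have hsum : d / (y - x + d) + (y - x) / (y - x + d) = 1 := by
    rw [← add_div, add_comm, div_self hpos.ne']
  have hl : 0 < (y - x) / (y - x + d) := div_pos (by linarith) hpos
  have hr : 0 < d / (y - x + d) := div_pos hd hpos
  have h₁ := hf.2 hx hyd hne hl hr (by linarith)
  have h₂ := hf.2 hx hyd hne hr hl hsum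
  simp only [smul_eq_mul] at h₁ h₂
  rw [show (y - x) / (y - x + d) * x + d / (y - x + d) * (y + d) = x + d by
    field_simp; ring] at h₁
  rw [show d / (y - x + d) * x + (y - x) / (y - x + d) * (y + d) = y by
    field_simp; ring] at h₂
  linear_combination h₁ + h₂ - (f x + f (y + d)) * hsum

theorem ConcaveOn.of_forall_le_add_mul {s : Set ℝ} (hs : Convex ℝ s) {f m : ℝ → ℝ}
    (h : ∀ x ∈ s, ∀ y ∈ s, f y ≤ f x + m x * (y - x)) : ConcaveOn ℝ s f := by
  refine ⟨hs, fun x hx y hy p q hp hq hpq => ?_⟩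
  have hz := hs hx hy hp hq hpq
  have h₁ := mul_le_mul_of_nonneg_left (h _ hz x hx) hp
  have h₂ := mul_le_mul_of_nonneg_left (h _ hz y hy) hq
  simp only [smul_eq_mul] at *
  generalize f (p * x + q * y) = v at *
  generalize m (p * x + q * y) = w at *
  obtain rfl : q = 1 - p := by linarith
  linarith

theorem F_eq_of_le {α β a k x : ℝ} (hβ : β ≠ 0) (hx : k - a ≤ x) :
    F α β a k x = x ^ α / α := by
  rw [F, max_eq_right (by linarith), Real.zero_rpow hβ, zero_div, add_zero]

theorem F_eq_of_ge {α β a k x : ℝ} (hx : x ≤ k - a) :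
    F α β a k x = x ^ α / α + (k - x - a) ^ β / β := by
  rw [F, max_eq_left (by linarith)]

/-- The supporting line of `k ↦ F k (c k)` at a first-order point `u` also bounds `F k'`. -/
theorem F_le_tangent {α β a k k' u x : ℝ} (hα : 0 < α) (hα1 : α < 1) (hβ : 0 < β) (hβ1 : β < 1)
    (hu : u ∈ Set.Ioo 0 (k - a)) (hfoc : u ^ (α - 1) = (k - u - a) ^ (β - 1))
    (hx : x ∈ Set.Icc 0 (k' - a)) :
    F α β a k' x ≤ F α β a k u + u ^ (α - 1) * (k' - k) := by
  rw [F_eq_of_ge hx.2, F_eq_of_ge hu.2.le]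
  have h₁ := Real.rpow_div_le_tangent hα hα1 hu.1 hx.1
  have h₂ := Real.rpow_div_le_tangent hβ hβ1 (u := k - u - a) (x := k' - x - a)
    (by linarith [hu.2]) (by linarith [hx.2])
  rw [← hfoc] at h₂
  linarith

theorem F_lt_of_ne {α β a k u x : ℝ} (hα : 0 < α) (hα1 : α < 1) (hβ : 0 < β) (hβ1 : β < 1)
    (hu : u ∈ Set.Ioo 0 (k - a)) (hfoc : u ^ (α - 1) = (k - u - a) ^ (β - 1))
    (hx : x ∈ Set.Icc 0 (k - a)) (hxu : x ≠ u) :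
    F α β a k x < F α β a k u := by
  rw [F_eq_of_ge hx.2, F_eq_of_ge hu.2.le]
  have h₁ := Real.rpow_div_lt_tangent hα hα1 hu.1 hx.1 hxu
  have h₂ := Real.rpow_div_le_tangent hβ hβ1 (u := k - u - a) (x := k - x - a)
    (by linarith [hu.2]) (by linarith [hx.2])
  rw [← hfoc] at h₂
  linarith

theorem exists_rpow_add_rpow_lt {α β a : ℝ} (hα : 0 < α) (hβ : 0 < β) (ha : 0 < a) :
    ∃ k, a < k ∧ (k - a) ^ α / α + (k - a) ^ β / β < k ^ α / α := by
  have hcont : ContinuousAt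
      (fun k : ℝ => k ^ α / α - ((k - a) ^ α / α + (k - a) ^ β / β)) a := by
    have h (p : ℝ) (hp : 0 < p) : ContinuousAt (fun k : ℝ => (k - a) ^ p / p) a :=
      ((continuousAt_id.sub continuousAt_const).rpow_const (Or.inr hp.le)).div_const p
    exact ((continuousAt_id.rpow_const (Or.inr hα.le)).div_const α).sub ((h α hα).add (h β hβ))
  have hpos : 0 < a ^ α / α - ((a - a) ^ α / α + (a - a) ^ β / β) := by
    rw [sub_self, Real.zero_rpow hα.ne', Real.zero_rpow hβ.ne']
    simpa using div_pos (Real.rpow_pos_of_pos ha α) hα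
  have hev := (hcont.eventually (lt_mem_nhds hpos)).filter_mono
    (nhdsWithin_le_nhds (s := Set.Ioi a))
  obtain ⟨k, hk, hak⟩ := (hev.and self_mem_nhdsWithin).exists
  exact ⟨k, hak, by linarith⟩

theorem exists_rpow_lt_rpow_sub {α β a : ℝ} (hα : 0 < α) (hαβ : α < β) (ha : 0 < a) :
    ∃ k, a < k ∧ k ^ α / α < (k - a) ^ β / β := by
  have hβ : 0 < β := hα.trans hαβ
  obtain ⟨t, ht, hat⟩ := (((tendsto_rpow_atTop (sub_pos.2 hαβ)).eventually_gt_atTop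
    (2 ^ α * β / α)).and (Filter.eventually_ge_atTop a)).exists
  have ht0 : 0 < t := ha.trans_le hat
  refine ⟨a + t, by linarith, ?_⟩
  rw [add_sub_cancel_left]
  calc (a + t) ^ α / α ≤ (2 * t) ^ α / α := by gcongr; linarith
    _ = t ^ α * (2 ^ α * β / α) / β := by
      rw [Real.mul_rpow two_pos.le ht0.le]; field_simp
    _ < t ^ α * t ^ (β - α) / β := by
      have := Real.rpow_pos_of_pos ht0 α
      gcongr
    _ = t ^ β / β := by rw [← Real.rpow_add ht0]; ring_nf

section ValueFunction

variable {α β a : ℝ} {c : ℝ → ℝ}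

theorem continuousOn_value (hα : 0 < α) (hα1 : α < 1) (hβ : 0 < β) (hβ1 : β < 1)
    (hc : ∀ k, a < k →
      c k ∈ Set.Ioo 0 (k - a) ∧ (c k) ^ (α - 1) = (k - c k - a) ^ (β - 1)) :
    ContinuousOn (fun k => F α β a k (c k)) (Set.Ioi a) := by
  refine ConcaveOn.continuousOn isOpen_Ioi (ConcaveOn.of_forall_le_add_mul (convex_Ioi a)
    (m := fun k => c k ^ (α - 1)) fun k hk k' hk' => ?_)
  exact F_le_tangent hα hα1 hβ hβ1 (hc k hk).1 (hc k hk).2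
    (Set.Ioo_subset_Icc_self (hc k' hk').1)

theorem strictMonoOn_value_sub (hα : 0 < α) (hα1 : α < 1) (hβ : 0 < β) (hβ1 : β < 1)
    (ha : 0 < a)
    (hc : ∀ k, a < k →
      c k ∈ Set.Ioo 0 (k - a) ∧ (c k) ^ (α - 1) = (k - c k - a) ^ (β - 1)) :
    StrictMonoOn (fun k => F α β a k (c k) - k ^ α / α) (Set.Ioi a) := by
  intro k hk k' hk' hkk'
  obtain ⟨⟨hc0, hck⟩, -⟩ := hc k hk
  have hk : a < k := hk
  have hmem : c k + (k' - k) ∈ Set.Icc 0 (k' - a) := ⟨by linarith, by linarith⟩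
  have hle := F_le_tangent hα hα1 hβ hβ1 (hc k' hk').1 (hc k' hk').2 hmem
  rw [sub_self, mul_zero, add_zero, F_eq_of_ge hmem.2,
    show k' - (c k + (k' - k)) - a = k - c k - a by ring] at hle
  have hconc := (Real.strictConcaveOn_rpow hα hα1).add_lt_add_of_translate
    (x := c k) (y := k) (d := k' - k) hc0.le (show (0 : ℝ) ≤ k + (k' - k) by linarith)
    (by linarith) (by linarith)
  have hdiv := div_lt_div_of_pos_right hconc hα
  rw [add_div, add_div, add_sub_cancel] at hdiv
  simp only
  rw [F_eq_of_ge hck.le]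
  linarith

end ValueFunction

/-- There exists a unique `k₀ > a` with `F_{k₀}(c(k₀)) = k₀^α/α`; the interior optimum
is below the boundary value on `(a, k₀)` and above it on `(k₀, ∞)`.  Consequently, for
`0 < k < k₀` the maximum of `F k` over `[0,k]` is `k^α/α`, attained only at `c = k`,
while for `k > k₀` it is `F k (c k)`, attained only at `c = c(k)`. -/
theorem stmt_5 (α β a : ℝ) (hα : 0 < α) (hαβ : α < β) (hβ : β < 1) (ha : 0 < a)
    (c : ℝ → ℝ)
    (hc : ∀ k, a < k →
      c k ∈ Set.Ioo 0 (k - a) ∧ (c k) ^ (α - 1) = (k - c k - a) ^ (β - 1)) :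
    ∃ k₀ : ℝ, a < k₀ ∧ F α β a k₀ (c k₀) = k₀ ^ α / α ∧
      (∀ k', a < k' → F α β a k' (c k') = k' ^ α / α → k' = k₀) ∧
      (∀ k, a < k → k < k₀ → F α β a k (c k) < k ^ α / α) ∧
      (∀ k, k₀ < k → k ^ α / α < F α β a k (c k)) ∧
      (∀ k, 0 < k → k < k₀ →
        (∀ x ∈ Set.Icc (0:ℝ) k, F α β a k x ≤ F α β a k k) ∧
        F α β a k k = k ^ α / α ∧
        (∀ x ∈ Set.Icc (0:ℝ) k, F α β a k x = F α β a k k → x = k)) ∧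
      (∀ k, k₀ < k →
        (∀ x ∈ Set.Icc (0:ℝ) k, F α β a k x ≤ F α β a k (c k)) ∧
        (∀ x ∈ Set.Icc (0:ℝ) k, F α β a k x = F α β a k (c k) → x = c k)) := by
  have hα1 : α < 1 := hαβ.trans hβ
  have hβ0 : 0 < β := hα.trans hαβ
  have hopt {k x : ℝ} (hk : a < k) (hx : x ∈ Set.Icc 0 (k - a)) (hne : x ≠ c k) :
      F α β a k x < F α β a k (c k) :=
    F_lt_of_ne hα hα1 hβ0 hβ (hc k hk).1 (hc k hk).2 hx hne
  have hmono := strictMonoOn_value_sub hα hα1 hβ0 hβ ha hc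
  have hcont : ContinuousOn (fun k => F α β a k (c k) - k ^ α / α) (Set.Ioi a) :=
    (continuousOn_value hα hα1 hβ0 hβ hc).sub
      ((continuousOn_id.rpow_const fun _ _ => Or.inr hα.le).div_const α)
  obtain ⟨k₀, hk₀, hzero⟩ : ∃ k₀ ∈ Set.Ioi a, F α β a k₀ (c k₀) - k₀ ^ α / α = 0 := by
    obtain ⟨k₁, hk₁, hlow⟩ := exists_rpow_add_rpow_lt hα hβ0 ha
    obtain ⟨k₂, hk₂, hhigh⟩ := exists_rpow_lt_rpow_sub hα hαβ ha
    obtain ⟨⟨hc0, hck⟩, -⟩ := hc k₁ hk₁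
    refine isPreconnected_Ioi.intermediate_value hk₁ hk₂ hcont ⟨?_, ?_⟩
    · have h₁ : c k₁ ^ α / α ≤ (k₁ - a) ^ α / α := by gcongr
      have h₂ : (k₁ - c k₁ - a) ^ β / β ≤ (k₁ - a) ^ β / β := by
        have : 0 ≤ k₁ - c k₁ - a := by linarith
        gcongr
        linarith
      rw [F_eq_of_ge hck.le]
      linarith
    · have h := hopt hk₂ (x := 0) ⟨le_rfl, by linarith⟩ (hc k₂ hk₂).1.1.ne
      rw [F_eq_of_ge (by linarith), Real.zero_rpow hα.ne', zero_div, zero_add, sub_zero] at h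
      linarith
  have hbelow (k : ℝ) (hk : a < k) (hlt : k < k₀) : F α β a k (c k) < k ^ α / α := by
    have := hmono hk hk₀ hlt
    simp only at this
    linarith
  have habove (k : ℝ) (hlt : k₀ < k) : k ^ α / α < F α β a k (c k) := by
    have := hmono hk₀ (lt_trans hk₀ hlt) hlt
    simp only at this
    linarith
  have hend (k : ℝ) : F α β a k k = k ^ α / α := F_eq_of_le hβ0.ne' (by linarith)
  have hright {k x : ℝ} (hx : x ∈ Set.Icc 0 k) (hxk : k - a ≤ x) (hne : x ≠ k) :
      F α β a k x < k ^ α / α := by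
    rw [F_eq_of_le hβ0.ne' hxk]
    have := Real.rpow_lt_rpow hx.1 (hx.2.lt_of_ne hne) hα
    gcongr
  have hcorner {k x : ℝ} (hlt : k < k₀) (hx : x ∈ Set.Icc 0 k) (hne : x ≠ k) :
      F α β a k x < F α β a k k := by
    rw [hend]
    rcases le_total (k - a) x with hxk | hxk
    · exact hright hx hxk hne
    · rcases eq_or_lt_of_le hxk with rfl | hxk'
      · exact hright hx le_rfl hne
      · have hk : a < k := by linarith [hx.1]
        refine lt_of_le_of_lt ?_ (hbelow k hk hlt)
        rcases eq_or_ne x (c k) with rfl | hxc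
        · exact le_rfl
        · exact (hopt hk ⟨hx.1, hxk⟩ hxc).le
  have hinterior {k x : ℝ} (hlt : k₀ < k) (hx : x ∈ Set.Icc 0 k) (hne : x ≠ c k) :
      F α β a k x < F α β a k (c k) := by
    rcases le_total (k - a) x with hxk | hxk
    · refine lt_of_le_of_lt ?_ (habove k hlt)
      rcases eq_or_ne x k with rfl | hxk'
      · exact (hend x).le
      · exact (hright hx hxk hxk').le
    · exact hopt (lt_trans hk₀ hlt) ⟨hx.1, hxk⟩ hne
  refine ⟨k₀, hk₀, sub_eq_zero.1 hzero, fun k hk h => ?_, hbelow, habove,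
    fun k _ hlt => ⟨fun x hx => ?_, hend k, fun x hx h => ?_⟩,
    fun k hlt => ⟨fun x hx => ?_, fun x hx h => ?_⟩⟩
  · exact hmono.injOn hk hk₀ ((sub_eq_zero.2 h).trans hzero.symm)
  · rcases eq_or_ne x k with rfl | hne
    · exact le_rfl
    · exact (hcorner hlt hx hne).le
  · by_contra hne
    exact (hcorner hlt hx hne).ne h
  · rcases eq_or_ne x (c k) with rfl | hne
    · exact le_rfl
    · exact (hinterior hlt hx hne).le
  · by_contra hne
    exact (hinterior hlt hx hne).ne h
end

section
/- (Optimal heterogeneous consumption asymptotics.) For each k > 0 let c*(k) ∈ [0,k] be a point at which F_k attains its maximum over [0,k], and set g*(k) = k − c*(k). Then there exists k₀ > a such that for every k with 0 < k < k₀ one has c*(k) = k and g*(k) = 0 (only basic goods are consumed when the total consumption is small); moreover lim_{k→∞} c*(k)/k^{(1−β)/(1−α)} = 1, lim_{k→∞} g*(k)/c*(k) = +∞, and lim_{k→∞} g*(k)/k = 1 (both consumptions tend to infinity, but luxury consumption accounts for almost all of the total). -/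
open Filter Topology

/-- Where the luxury good is not consumed beyond its threshold, `F` is the basic term alone. -/
lemma F_eq_of_sub_le {α β a k c : ℝ} (hβ : 0 < β) (h : k - c - a ≤ 0) :
    F α β a k c = c ^ α / α := by
  simp [F, max_eq_right h, Real.zero_rpow hβ.ne']

lemma F_eq_of_le_sub {α β a k c : ℝ} (h : 0 ≤ k - c - a) :
    F α β a k c = c ^ α / α + (k - c - a) ^ β / β := by
  simp [F, max_eq_left h]

/-- For total consumption slightly above `a`, spending beyond the luxury threshold is never
as good as consuming only basic goods. -/
lemma exists_pos_rpow_add_rpow_lt {α β a : ℝ} (hα : 0 < α) (hβ : 0 < β) (ha : 0 < a) :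
    ∃ δ > 0, δ ^ α / α + δ ^ β / β < a ^ α / α := by
  have hcont : ContinuousAt (fun δ : ℝ => δ ^ α / α + δ ^ β / β) 0 :=
    ((Real.continuousAt_rpow_const 0 α (Or.inr hα.le)).div_const α).add
      ((Real.continuousAt_rpow_const 0 β (Or.inr hβ.le)).div_const β)
  have hlim : Tendsto (fun δ : ℝ => δ ^ α / α + δ ^ β / β) (𝓝[>] 0) (𝓝 0) := by
    have := hcont.tendsto.mono_left (nhdsWithin_le_nhds (s := Set.Ioi 0))
    simpa [Real.zero_rpow hα.ne', Real.zero_rpow hβ.ne'] using this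
  have hpos : 0 < a ^ α / α := by positivity
  obtain ⟨δ, hδ, hδ0⟩ := ((hlim.eventually (gt_mem_nhds hpos)).and self_mem_nhdsWithin).exists
  exact ⟨δ, hδ0, hδ⟩

lemma maximizer_eq_of_small {α β a δ k c : ℝ} (hα : 0 < α) (hβ : 0 < β) (ha : 0 < a)
    (hδ : δ ^ α / α + δ ^ β / β < a ^ α / α) (hkδ : k < a + δ)
    (hc : c ∈ Set.Icc 0 k) (hmax : F α β a k k ≤ F α β a k c) : c = k := by
  obtain ⟨hc0, hck⟩ := hc
  by_contra hne
  have hlt : c < k := lt_of_le_of_ne hck hne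
  rw [F_eq_of_sub_le hβ (by linarith : k - k - a ≤ 0)] at hmax
  rcases le_total (k - c - a) 0 with h | h
  · rw [F_eq_of_sub_le hβ h] at hmax
    have : c ^ α / α < k ^ α / α := by gcongr
    linarith
  · rw [F_eq_of_le_sub h] at hmax
    have h1 : c ^ α / α ≤ δ ^ α / α := by gcongr; linarith
    have h2 : (k - c - a) ^ β / β ≤ δ ^ β / β := by gcongr; linarith
    have h3 : a ^ α / α ≤ k ^ α / α := by gcongr; linarith
    linarith

/-- For large total consumption, consuming luxury goods only beats consuming basic goods only. -/
lemma eventually_rpow_lt_rpow_sub {α β a : ℝ} (hα : 0 < α) (hαβ : α < β) :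
    ∀ᶠ k : ℝ in atTop, k ^ α / α < (k - a) ^ β / β := by
  have hβ : 0 < β := hα.trans hαβ
  have h1 : ∀ᶠ k : ℝ in atTop, β * 2 ^ β / α < k ^ (β - α) :=
    (tendsto_rpow_atTop (sub_pos.2 hαβ)).eventually_gt_atTop _
  filter_upwards [h1, eventually_gt_atTop 0, eventually_ge_atTop (2 * a)] with k h1 hk hka
  have h2 : (k / 2) ^ β / β ≤ (k - a) ^ β / β := by gcongr; linarith
  refine lt_of_lt_of_le ?_ h2
  rw [Real.div_rpow hk.le zero_le_two, div_div, div_lt_div_iff₀ hα (by positivity)]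
  rw [Real.rpow_sub hk, div_lt_div_iff₀ hα (by positivity)] at h1
  linarith

/-- First-order condition at an interior maximizer. -/
lemma eq_rpow_of_isMaxOn {α β a k c : ℝ} (hα : 0 < α) (hβ : 0 < β) (hα1 : α < 1)
    (ha : 0 < a) (hc : 0 < c) (hs : 0 < k - c - a)
    (hmax : ∀ x ∈ Set.Icc 0 k, F α β a k x ≤ F α β a k c) :
    c = (k - c - a) ^ ((1 - β) / (1 - α)) := by
  have hloc : IsLocalMax (fun x => x ^ α / α + (k - x - a) ^ β / β) c := by
    have hnhds : ∀ᶠ x in 𝓝 c, x ∈ Set.Ioo 0 (k - a) := Ioo_mem_nhds hc (by linarith)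
    filter_upwards [hnhds] with x hx
    have := hmax x ⟨hx.1.le, by linarith [hx.2]⟩
    rwa [F_eq_of_le_sub hs.le, F_eq_of_le_sub (by linarith [hx.2])] at this
  have hd1 : HasDerivAt (fun x : ℝ => x ^ α / α) (α * c ^ (α - 1) / α) c :=
    (Real.hasDerivAt_rpow_const (Or.inl hc.ne')).div_const α
  have hlin : HasDerivAt (fun x : ℝ => k - x - a) (-1) c :=
    ((hasDerivAt_id c).const_sub k).sub_const a
  have hd2 := (hlin.rpow_const (p := β) (Or.inl hs.ne')).div_const β
  have hzero := hloc.hasDerivAt_eq_zero (hd1.add hd2)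
  have hfoc : c ^ (α - 1) = (k - c - a) ^ (β - 1) := by
    field_simp at hzero
    linarith
  have hα1' : α - 1 ≠ 0 := by linarith
  calc c = (c ^ (α - 1)) ^ (α - 1)⁻¹ := (Real.rpow_rpow_inv hc.le hα1').symm
    _ = (k - c - a) ^ ((β - 1) * (α - 1)⁻¹) := by rw [hfoc, Real.rpow_mul hs.le]
    _ = (k - c - a) ^ ((1 - β) / (1 - α)) := by
      rw [← div_eq_mul_inv, ← neg_div_neg_eq, neg_sub, neg_sub]

/-- Consuming no basic goods is not optimal. -/
lemma F_zero_lt_F_one {α β a k : ℝ} (hα : 0 < α) (hαβ : α < β) (hβ : β < 1)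
    (hk : a + 1 ≤ k) : F α β a k 0 < F α β a k 1 := by
  have hβ0 : 0 < β := hα.trans hαβ
  rw [F_eq_of_le_sub (by linarith), F_eq_of_le_sub (by linarith),
    Real.zero_rpow hα.ne', Real.one_rpow]
  have h := Real.rpow_add_le_add_rpow (by linarith : 0 ≤ k - 1 - a) zero_le_one hβ0.le hβ.le
  rw [Real.one_rpow, show k - 1 - a + 1 = k - 0 - a by ring] at h
  have h1 : (k - 0 - a) ^ β / β ≤ (k - 1 - a) ^ β / β + 1 / β := by
    rw [← add_div]; gcongr
  have h2 : 1 / β < 1 / α := one_div_lt_one_div_of_lt hα hαβ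
  simp only [zero_div]
  linarith

lemma eventually_maximizer_eq_rpow {α β a : ℝ} (hα : 0 < α) (hαβ : α < β) (hβ : β < 1)
    (ha : 0 < a) {c : ℝ → ℝ} (hmem : ∀ k, 0 < k → c k ∈ Set.Icc (0 : ℝ) k)
    (hmax : ∀ k, 0 < k → ∀ x ∈ Set.Icc (0 : ℝ) k, F α β a k x ≤ F α β a k (c k)) :
    ∀ᶠ k in atTop, 0 < c k ∧ 0 < k - c k - a ∧
      c k = (k - c k - a) ^ ((1 - β) / (1 - α)) := by
  have hβ0 : 0 < β := hα.trans hαβ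
  filter_upwards [eventually_rpow_lt_rpow_sub (a := a) hα hαβ, eventually_ge_atTop (a + 1)]
    with k hlt hk
  have hk0 : 0 < k := by linarith
  obtain ⟨hc0, hck⟩ := hmem k hk0
  have hc : 0 < c k := by
    refine lt_of_le_of_ne hc0 fun h => ?_
    have := hmax k hk0 1 ⟨zero_le_one, by linarith⟩
    rw [← h] at this
    exact this.not_gt (F_zero_lt_F_one hα hαβ hβ hk)
  have hs : 0 < k - c k - a := by
    by_contra! h
    have := hmax k hk0 0 ⟨le_rfl, hk0.le⟩
    rw [F_eq_of_sub_le hβ0 h, F_eq_of_le_sub (by linarith), Real.zero_rpow hα.ne',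
      zero_div, zero_add, sub_zero] at this
    have : c k ^ α / α ≤ k ^ α / α := by gcongr
    linarith
  exact ⟨hc, hs, eq_rpow_of_isMaxOn hα hβ0 (hαβ.trans hβ) ha hc hs (hmax k hk0)⟩

/-- Optimal heterogeneous consumption asymptotics: if for each `k > 0`, `cstar k` is a
maximizer of `F k` over `[0,k]` (with `g*(k) = k - cstar k` the luxury consumption),
then there is `k₀ > a` such that `cstar k = k` and `g*(k) = 0` for all `0 < k < k₀`;
moreover `cstar k / k^((1-β)/(1-α)) → 1`, `g*(k)/cstar k → ∞`, and `g*(k)/k → 1`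
as `k → ∞`. -/
theorem stmt_6 (α β a : ℝ) (hα : 0 < α) (hαβ : α < β) (hβ : β < 1) (ha : 0 < a)
    (cstar : ℝ → ℝ)
    (hmem : ∀ k, 0 < k → cstar k ∈ Set.Icc (0:ℝ) k)
    (hmax : ∀ k, 0 < k → ∀ x ∈ Set.Icc (0:ℝ) k, F α β a k x ≤ F α β a k (cstar k)) :
    (∃ k₀, a < k₀ ∧ ∀ k, 0 < k → k < k₀ → cstar k = k ∧ k - cstar k = 0) ∧
    Filter.Tendsto (fun k => cstar k / k ^ ((1 - β) / (1 - α))) Filter.atTop (nhds 1) ∧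
    Filter.Tendsto (fun k => (k - cstar k) / cstar k) Filter.atTop Filter.atTop ∧
    Filter.Tendsto (fun k => (k - cstar k) / k) Filter.atTop (nhds 1) := by
  have hβ0 : 0 < β := hα.trans hαβ
  have hα1 : 0 < 1 - α := by linarith
  set γ := (1 - β) / (1 - α)
  have hγ0 : 0 < γ := div_pos (by linarith) hα1
  have hγ1 : γ < 1 := (div_lt_one hα1).2 (by linarith)
  have hev := eventually_maximizer_eq_rpow hα hαβ hβ ha hmem hmax
  have hratio : Tendsto (fun k => cstar k / k) atTop (𝓝 0) := by
    refine squeeze_zero' (g := fun k : ℝ => k ^ (-(1 - γ))) ?_ ?_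
      (tendsto_rpow_neg_atTop (by linarith))
    · filter_upwards [hev, eventually_gt_atTop 0] with k hk hk0
      exact div_nonneg hk.1.le hk0.le
    · filter_upwards [hev, eventually_gt_atTop 0] with k ⟨hc, hs, heq⟩ hk0
      rw [neg_sub, Real.rpow_sub hk0, Real.rpow_one]
      gcongr
      rw [heq]
      gcongr
      linarith
  refine ⟨?_, ?_, ?_, ?_⟩
  · obtain ⟨δ, hδ0, hδ⟩ := exists_pos_rpow_add_rpow_lt hα hβ0 ha
    refine ⟨a + δ, by linarith, fun k hk0 hk => ?_⟩
    have := maximizer_eq_of_small hα hβ0 ha hδ hk (hmem k hk0)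
      (hmax k hk0 k ⟨hk0.le, le_rfl⟩)
    exact ⟨this, by linarith⟩
  · have hlim : Tendsto (fun k => (1 - cstar k / k - a / k) ^ γ) atTop (𝓝 1) := by
      have h := (hratio.const_sub 1).sub (tendsto_const_nhds (x := a) |>.div_atTop tendsto_id)
      simpa using h.rpow_const (p := γ) (Or.inr hγ0.le)
    refine hlim.congr' ?_
    filter_upwards [hev, eventually_gt_atTop 0] with k ⟨hc, hs, heq⟩ hk0
    have hdiv : 1 - cstar k / k - a / k = (k - cstar k - a) / k := by field_simp
    rw [hdiv, Real.div_rpow hs.le hk0.le, ← heq]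
  · have hpos : Tendsto (fun k => cstar k / k) atTop (𝓝[>] 0) := by
      refine tendsto_nhdsWithin_iff.2 ⟨hratio, ?_⟩
      filter_upwards [hev, eventually_gt_atTop 0] with k hk hk0
      exact div_pos hk.1 hk0
    refine (tendsto_atTop_add_const_right atTop (-1) hpos.inv_tendsto_nhdsGT_zero).congr' ?_
    filter_upwards [hev] with k hk
    have := hk.1.ne'
    simp only [Pi.inv_apply, inv_div]
    field_simp
    ring
  · have h := hratio.const_sub 1
    rw [sub_zero] at h
    refine h.congr' ?_
    filter_upwards [eventually_gt_atTop 0] with k hk0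
    field_simp
end

section
/- (Dual transformation of the pre-retirement variational operator.) Let I ⊆ ℝ be an open interval and let ζ : I × (0,∞) → ℝ have continuous partial derivatives ∂_t ζ, ∂_x ζ, ∂_{xx} ζ with ∂_{xx} ζ < 0 everywhere, such that for each t ∈ I the map x ↦ ∂_x ζ(t,x) is a bijection from (0,∞) onto (0,∞) with inverse x(t,·), and let Ŵ(t,y) = ζ(t,x(t,y)) − x(t,y)·y. Let h : (0,∞) → ℝ be any function and let θ ≥ 0 and r, I₀, ρ, L be real numbers. Then for every t ∈ I and x > 0, writing y = ∂_x ζ(t,x), one has the identity: −∂_t ζ(t,x) + θ·(∂_x ζ(t,x))² / (2 ∂_{xx} ζ(t,x)) − (r x + I₀) ∂_x ζ(t,x) − h(∂_x ζ(t,x)) + ρ ζ(t,x) + L = −∂_t Ŵ(t,y) − (θ/2) y² ∂_{yy} Ŵ(t,y) − (ρ − r) y ∂_y Ŵ(t,y) + ρ Ŵ(t,y) − y I₀ − h(y) + L. -/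
open Filter Topology

theorem le_tangent_of_antitoneOn_deriv {f f' : ℝ → ℝ} {s : Set ℝ} (hs : s.OrdConnected)
    (hf : ∀ x ∈ s, HasDerivAt f (f' x) x) (hf' : AntitoneOn f' s) {a x : ℝ}
    (ha : a ∈ s) (hx : x ∈ s) : f x ≤ f a + f' a * (x - a) := by
  rcases lt_trichotomy a x with hax | rfl | hax
  · have hsub : Set.Icc a x ⊆ s := hs.out ha hx
    obtain ⟨c, hc, hc'⟩ := exists_hasDerivAt_eq_slope f f' hax
      (fun z hz => (hf z (hsub hz)).continuousAt.continuousWithinAt)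
      (fun z hz => hf z (hsub (Set.Ioo_subset_Icc_self hz)))
    have hle := hf' ha (hsub (Set.Ioo_subset_Icc_self hc)) hc.1.le
    have hpos : 0 < x - a := sub_pos.2 hax
    rw [eq_div_iff hpos.ne'] at hc'
    nlinarith
  · simp
  · have hsub : Set.Icc x a ⊆ s := hs.out hx ha
    obtain ⟨c, hc, hc'⟩ := exists_hasDerivAt_eq_slope f f' hax
      (fun z hz => (hf z (hsub hz)).continuousAt.continuousWithinAt)
      (fun z hz => hf z (hsub (Set.Ioo_subset_Icc_self hz)))
    have hle := hf' (hsub (Set.Ioo_subset_Icc_self hc)) ha hc.2.le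
    have hpos : 0 < a - x := sub_pos.2 hax
    rw [eq_div_iff hpos.ne'] at hc'
    nlinarith

/-- The inverses of a jointly continuous family of strictly decreasing functions on `(0, ∞)`
are jointly continuous. -/
theorem continuousAt_inverse_of_strictAntiOn {I : Set ℝ} (hI : IsOpen I) {g X : ℝ → ℝ → ℝ}
    (hg : ContinuousOn (fun p : ℝ × ℝ => g p.1 p.2) (I ×ˢ Set.Ioi 0))
    (hanti : ∀ t ∈ I, StrictAntiOn (g t) (Set.Ioi 0))
    (hX : ∀ t ∈ I, ∀ y > (0:ℝ), 0 < X t y ∧ g t (X t y) = y)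
    {t y : ℝ} (ht : t ∈ I) (hy : 0 < y) :
    ContinuousAt (fun p : ℝ × ℝ => X p.1 p.2) (t, y) := by
  have hslice : ∀ x > (0:ℝ), ContinuousAt (fun p : ℝ × ℝ => g p.1 x) (t, y) := fun x hx =>
    ContinuousAt.comp (f := fun p : ℝ × ℝ => (p.1, x)) (x := (t, y))
      (hg.continuousAt ((hI.prod isOpen_Ioi).mem_nhds ⟨ht, hx⟩)) (by fun_prop)
  have hdom : ∀ᶠ p : ℝ × ℝ in 𝓝 (t, y), p.1 ∈ I ∧ 0 < p.2 :=
    (hI.prod isOpen_Ioi).mem_nhds (⟨ht, hy⟩ : (t, y) ∈ I ×ˢ Set.Ioi (0:ℝ))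
  obtain ⟨hx0, hgx⟩ := hX t ht y hy
  refine tendsto_order.2 ⟨fun a ha => ?_, fun b hb => ?_⟩
  · obtain ⟨c, hac, hcx⟩ := exists_between (max_lt ha hx0)
    have hc : 0 < c := (le_max_right _ _).trans_lt hac
    have hlt : y < g t c := by simpa [hgx] using hanti t ht hc hx0 hcx
    filter_upwards [hdom, continuousAt_snd.eventually_lt (hslice c hc) hlt] with p hp hpc
    obtain ⟨h1, h2⟩ := hX p.1 hp.1 p.2 hp.2
    refine ((le_max_left _ _).trans_lt hac).trans
      (((hanti p.1 hp.1).lt_iff_gt h1 hc).1 (by rwa [h2]))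
  · have hb0 : 0 < b := hx0.trans hb
    have hlt : g t b < y := by simpa [hgx] using hanti t ht hx0 hb0 hb
    filter_upwards [hdom, (hslice b hb0).eventually_lt continuousAt_snd hlt] with p hp hpc
    obtain ⟨h1, h2⟩ := hX p.1 hp.1 p.2 hp.2
    exact ((hanti p.1 hp.1).lt_iff_gt hb0 h1).1 (by rwa [h2])

/-- Continuity of a partial derivative makes the first-order expansion locally uniform in the
other variable. -/
theorem eventually_abs_sub_sub_le_of_continuousAt_partial {f f' : ℝ → ℝ → ℝ} {t x : ℝ}
    (hf : ∀ᶠ p : ℝ × ℝ in 𝓝 (t, x), HasDerivAt (fun s => f s p.2) (f' p.1 p.2) p.1)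
    (hf' : ContinuousAt (fun p : ℝ × ℝ => f' p.1 p.2) (t, x)) {ε : ℝ} (hε : 0 < ε) :
    ∀ᶠ p : ℝ × ℝ in 𝓝 (t, x),
      |f p.1 p.2 - f t p.2 - f' t x * (p.1 - t)| ≤ ε * |p.1 - t| := by
  have hclose : ∀ᶠ p : ℝ × ℝ in 𝓝 (t, x), |f' p.1 p.2 - f' t x| < ε :=
    hf'.eventually (Metric.ball_mem_nhds _ hε)
  obtain ⟨δ, hδ, hball⟩ := Metric.eventually_nhds_iff_ball.1 (hf.and hclose)
  refine Metric.eventually_nhds_iff_ball.2 ⟨δ, hδ, fun p hp => ?_⟩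
  rw [← ball_prod_same] at hp hball
  have hmvt := (convex_ball t δ).norm_image_sub_le_of_norm_hasDerivWithin_le
    (f := fun s => f s p.2 - f' t x * s) (f' := fun s => f' s p.2 - f' t x) (C := ε)
    (fun s hs => by
      simpa using ((hball (s, p.2) ⟨hs, hp.2⟩).1.fun_sub
        ((hasDerivAt_id s).const_mul (f' t x))).hasDerivWithinAt)
    (fun s hs => (hball (s, p.2) ⟨hs, hp.2⟩).2.le) (Metric.mem_ball_self hδ) hp.1
  simp only [Real.norm_eq_abs] at hmvt
  convert hmvt using 2
  ring

/-- Envelope theorem: along a continuous selection of maximizers, the value function has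
the partial derivative of the objective as its derivative. -/
theorem hasDerivAt_of_isMax_selection {F F' : ℝ → ℝ → ℝ} {ξ : ℝ → ℝ} {t : ℝ}
    (hF : ∀ᶠ p : ℝ × ℝ in 𝓝 (t, ξ t), HasDerivAt (fun s => F s p.2) (F' p.1 p.2) p.1)
    (hF' : ContinuousAt (fun p : ℝ × ℝ => F' p.1 p.2) (t, ξ t))
    (hξ : ContinuousAt ξ t)
    (hle : ∀ᶠ s in 𝓝 t, F s (ξ t) ≤ F s (ξ s) ∧ F t (ξ s) ≤ F t (ξ t)) :
    HasDerivAt (fun s => F s (ξ s)) (F' t (ξ t)) t := by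
  rw [hasDerivAt_iff_isLittleO, Asymptotics.isLittleO_iff]
  intro ε hε
  have hunif := eventually_abs_sub_sub_le_of_continuousAt_partial hF hF' hε
  have hmoving : Tendsto (fun s => (s, ξ s)) (𝓝 t) (𝓝 (t, ξ t)) :=
    continuousAt_id.prodMk hξ
  have hfixed : Tendsto (fun s => (s, ξ t)) (𝓝 t) (𝓝 (t, ξ t)) :=
    continuousAt_id.prodMk continuousAt_const
  filter_upwards [hmoving.eventually hunif, hfixed.eventually hunif, hle] with s h1 h2 h3
  simp only [Real.norm_eq_abs, smul_eq_mul] at h1 h2 ⊢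
  rw [abs_le] at h1 h2 ⊢
  constructor <;> linarith [h1.1, h1.2, h2.1, h2.2, h3.1, h3.2]


/-- Dual transformation of the pre-retirement variational operator: the fully nonlinear
pre-retirement HJB operator applied to the primal function `ζ` at `(t,x)` equals the
linear dual operator applied to the dual transform `Ŵ(t,y) = ζ(t,X(t,y)) - X(t,y)·y`
at `(t, y)` with `y = ∂ₓζ(t,x)`. -/
theorem stmt_13 (I : Set ℝ) (hIopen : IsOpen I) (hIconn : I.OrdConnected)
    (ζ ζt ζx ζxx X : ℝ → ℝ → ℝ)
    (hζt : ∀ t ∈ I, ∀ x > (0:ℝ), HasDerivAt (fun s => ζ s x) (ζt t x) t)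
    (hζx : ∀ t ∈ I, ∀ x > (0:ℝ), HasDerivAt (fun x' => ζ t x') (ζx t x) x)
    (hζxx : ∀ t ∈ I, ∀ x > (0:ℝ), HasDerivAt (fun x' => ζx t x') (ζxx t x) x)
    (hcontt : ContinuousOn (fun p : ℝ × ℝ => ζt p.1 p.2) (I ×ˢ Set.Ioi 0))
    (hcontx : ContinuousOn (fun p : ℝ × ℝ => ζx p.1 p.2) (I ×ˢ Set.Ioi 0))
    (hcontxx : ContinuousOn (fun p : ℝ × ℝ => ζxx p.1 p.2) (I ×ˢ Set.Ioi 0))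
    (hneg : ∀ t ∈ I, ∀ x > (0:ℝ), ζxx t x < 0)
    (hbij : ∀ t ∈ I, Set.BijOn (ζx t) (Set.Ioi 0) (Set.Ioi 0))
    (hX : ∀ t ∈ I, ∀ y > (0:ℝ), 0 < X t y ∧ ζx t (X t y) = y)
    (hXinv : ∀ t ∈ I, ∀ x > (0:ℝ), X t (ζx t x) = x)
    (h : ℝ → ℝ) (θ r I₀ ρ L : ℝ) (hθ : 0 ≤ θ) :
    ∀ t ∈ I, ∀ x > (0:ℝ),
      -ζt t x + θ * (ζx t x) ^ 2 / (2 * ζxx t x) - (r * x + I₀) * ζx t x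
          - h (ζx t x) + ρ * ζ t x + L
        = -(deriv (fun s => ζ s (X s (ζx t x)) - X s (ζx t x) * ζx t x) t)
          - θ / 2 * (ζx t x) ^ 2 *
            (deriv (fun z => deriv (fun w => ζ t (X t w) - X t w * w) z) (ζx t x))
          - (ρ - r) * ζx t x * (deriv (fun z => ζ t (X t z) - X t z * z) (ζx t x))
          + ρ * (ζ t (X t (ζx t x)) - X t (ζx t x) * ζx t x)
          - ζx t x * I₀ - h (ζx t x) + L := by
  intro t ht x hx
  have hanti : ∀ t ∈ I, StrictAntiOn (ζx t) (Set.Ioi 0) := fun s hs =>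
    strictAntiOn_of_hasDerivWithinAt_neg (convex_Ioi 0)
      (fun z hz => (hζxx s hs z hz).continuousAt.continuousWithinAt)
      (fun z hz => (hζxx s hs z (interior_subset hz)).hasDerivWithinAt)
      (fun z hz => hneg s hs z (interior_subset hz))
  have hy : 0 < ζx t x := (hbij t ht).mapsTo hx
  have hXx : X t (ζx t x) = x := hXinv t ht x hx
  have hXcont : ∀ z > (0:ℝ), ContinuousAt (fun p : ℝ × ℝ => X p.1 p.2) (t, z) := fun z hz =>
    continuousAt_inverse_of_strictAntiOn hIopen hcontx hanti hX ht hz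
  have hXy : ∀ z > (0:ℝ), HasDerivAt (X t) (ζxx t (X t z))⁻¹ z := fun z hz =>
    HasDerivAt.of_local_left_inverse
      (ContinuousAt.comp (f := fun w : ℝ => (t, w)) (x := z) (hXcont z hz) (by fun_prop))
      (hζxx t ht _ (hX t ht z hz).1) (hneg t ht _ (hX t ht z hz).1).ne
      ((lt_mem_nhds hz).mono fun w hw => (hX t ht w hw).2)
  have hWy : ∀ z > (0:ℝ), HasDerivAt (fun w => ζ t (X t w) - X t w * w) (-X t z) z := by
    intro z hz
    have hζX := (hζx t ht _ (hX t ht z hz).1).comp z (hXy z hz)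
    rw [(hX t ht z hz).2] at hζX
    refine (hζX.sub ((hXy z hz).mul (hasDerivAt_id' z))).congr_deriv ?_
    ring
  have hWyy : deriv (fun z => deriv (fun w => ζ t (X t w) - X t w * w) z) (ζx t x)
      = -(ζxx t x)⁻¹ := by
    have heq : (fun z => deriv (fun w => ζ t (X t w) - X t w * w) z)
        =ᶠ[𝓝 (ζx t x)] fun z => -X t z :=
      (lt_mem_nhds hy).mono fun z hz => (hWy z hz).deriv
    rw [heq.deriv_eq]
    simpa [hXx] using (hXy _ hy).fun_neg.deriv
  have hmax : ∀ s ∈ I, ∀ z > (0:ℝ),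
      ζ s z - z * ζx t x ≤ ζ s (X s (ζx t x)) - X s (ζx t x) * ζx t x := by
    intro s hs z hz
    obtain ⟨hpos, hinv⟩ := hX s hs _ hy
    have htan := le_tangent_of_antitoneOn_deriv Set.ordConnected_Ioi (hζx s hs)
      (hanti s hs).antitoneOn hpos hz
    rw [hinv] at htan
    linarith
  have hWt : HasDerivAt (fun s => ζ s (X s (ζx t x)) - X s (ζx t x) * ζx t x) (ζt t x) t := by
    have hnhds : I ×ˢ Set.Ioi (0:ℝ) ∈ 𝓝 (t, x) := (hIopen.prod isOpen_Ioi).mem_nhds ⟨ht, hx⟩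
    have henv := hasDerivAt_of_isMax_selection (F := fun s z => ζ s z - z * ζx t x) (F' := ζt)
      (ξ := fun s => X s (ζx t x)) (t := t)
    simp only [hXx] at henv
    refine henv ?_ (hcontt.continuousAt hnhds) ?_ ?_
    · filter_upwards [hnhds] with p hp
      exact (hζt p.1 hp.1 p.2 hp.2).sub_const _
    · exact ContinuousAt.comp (f := fun s : ℝ => (s, ζx t x)) (x := t) (hXcont _ hy)
        (by fun_prop)
    · filter_upwards [hIopen.mem_nhds ht] with s hs
      refine ⟨hmax s hs x hx, ?_⟩
      simpa only [hXx] using hmax t ht _ (hX s hs _ hy).1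
  rw [hWt.deriv, hWyy, (hWy _ hy).deriv, hXx]
  have hne := (hneg t ht x hx).ne
  field_simp
  ring
end

section
/- Let a > 0 and define Φ : (a,∞) → ℝ by Φ(k) = (4/3)·√( √(k−a+1/4) − 1/2 )·( √(k−a+1/4) + 1 ) − 2√k. Then Φ has a unique zero k₀ ∈ (a,∞); moreover Φ(k) < 0 for a < k < k₀ and Φ(k) > 0 for k > k₀. Consequently, the total utility ū(k) = max_{0 ≤ c ≤ k} ( 2c^{1/2} + (4/3)((k−c−a)⁺)^{3/4} ) equals 2√k for 0 ≤ k ≤ k₀ and equals (4/3)·√( √(k−a+1/4) − 1/2 )·( √(k−a+1/4) + 1 ) for k ≥ k₀. -/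
/-- The difference between the interior (luxury-consuming) optimal value and the
boundary (basic-only) value `2√k` for the utility `u(c,g) = 2√c + (4/3)((g-a)⁺)^(3/4)`. -/
noncomputable def Phi (a k : ℝ) : ℝ :=
  (4/3) * Real.sqrt (Real.sqrt (k - a + 1/4) - 1/2) * (Real.sqrt (k - a + 1/4) + 1)
    - 2 * Real.sqrt k

/-- The total utility `ū(k) = max_{0 ≤ c ≤ k} (2√c + (4/3)((k-c-a)⁺)^(3/4))`. -/
noncomputable def ubarEx (a k : ℝ) : ℝ :=
  sSup {v | ∃ c, 0 ≤ c ∧ c ≤ k ∧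
    v = 2 * Real.sqrt c + (4/3) * (max (k - c - a) 0) ^ ((3:ℝ)/4)}

theorem sqrt_sq_add_pow_four (s : ℝ) : √(s ^ 2 + s ^ 4 + 1 / 4) = s ^ 2 + 1 / 2 := by
  rw [show s ^ 2 + s ^ 4 + 1 / 4 = (s ^ 2 + 1 / 2) ^ 2 by ring]
  exact Real.sqrt_sq (by positivity)

/-- The interior value in terms of the parameter `s` with `k = a + s² + s⁴`. -/
theorem interior_value_eq {a s : ℝ} (hs : 0 ≤ s) :
    (4/3) * Real.sqrt (Real.sqrt (a + s ^ 2 + s ^ 4 - a + 1/4) - 1/2)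
      * (Real.sqrt (a + s ^ 2 + s ^ 4 - a + 1/4) + 1) = 2 * s + 4 / 3 * s ^ 3 := by
  rw [show a + s ^ 2 + s ^ 4 - a + 1/4 = s ^ 2 + s ^ 4 + 1 / 4 by ring,
    sqrt_sq_add_pow_four, add_sub_cancel_right, Real.sqrt_sq hs]
  ring

theorem Phi_eq {a s : ℝ} (hs : 0 ≤ s) :
    Phi a (a + s ^ 2 + s ^ 4) = 2 * s + 4 / 3 * s ^ 3 - 2 * √(a + s ^ 2 + s ^ 4) := by
  rw [Phi, interior_value_eq hs]

theorem exists_eq_add_sq_add_pow_four {a k : ℝ} (hk : a < k) :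
    ∃ s, 0 < s ∧ k = a + s ^ 2 + s ^ 4 := by
  have h : 1 / 2 < √(k - a + 1 / 4) := Real.lt_sqrt_of_sq_lt (by linarith)
  have h2 : √(k - a + 1 / 4) ^ 2 = k - a + 1 / 4 := Real.sq_sqrt (by linarith)
  refine ⟨√(√(k - a + 1 / 4) - 1 / 2), Real.sqrt_pos.2 (by linarith), ?_⟩
  have h3 := Real.sq_sqrt (sub_nonneg.2 h.le)
  rw [show ∀ x : ℝ, x ^ 4 = (x ^ 2) ^ 2 by intro x; ring, h3]
  linarith

theorem Phi_neg {a s : ℝ} (hs : 0 ≤ s) (h : s ^ 4 / 3 + 4 / 9 * s ^ 6 < a) :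
    Phi a (a + s ^ 2 + s ^ 4) < 0 := by
  have : s + 2 / 3 * s ^ 3 < √(a + s ^ 2 + s ^ 4) := Real.lt_sqrt_of_sq_lt (by linarith)
  rw [Phi_eq hs]
  linarith

theorem Phi_pos {a s : ℝ} (hs : 0 < s) (h : a < s ^ 4 / 3 + 4 / 9 * s ^ 6) :
    0 < Phi a (a + s ^ 2 + s ^ 4) := by
  have : √(a + s ^ 2 + s ^ 4) < s + 2 / 3 * s ^ 3 :=
    (Real.sqrt_lt' (by positivity)).2 (by linarith)
  rw [Phi_eq hs.le]
  linarith

theorem Phi_eq_zero {a s : ℝ} (hs : 0 ≤ s) (h : s ^ 4 / 3 + 4 / 9 * s ^ 6 = a) :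
    Phi a (a + s ^ 2 + s ^ 4) = 0 := by
  have : √(a + s ^ 2 + s ^ 4) = s + 2 / 3 * s ^ 3 := by
    rw [← h, show s ^ 4 / 3 + 4 / 9 * s ^ 6 + s ^ 2 + s ^ 4 = (s + 2 / 3 * s ^ 3) ^ 2 by ring]
    exact Real.sqrt_sq (by positivity)
  rw [Phi_eq hs, this]
  ring

theorem exists_pos_critical {a : ℝ} (ha : 0 < a) :
    ∃ s : ℝ, 0 < s ∧ s ^ 4 / 3 + 4 / 9 * s ^ 6 = a := by
  have hc : ContinuousOn (fun s : ℝ => s ^ 4 / 3 + 4 / 9 * s ^ 6) (Set.Icc 0 (1 + 3 * a)) := by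
    fun_prop
  have hb : a ≤ (1 + 3 * a) ^ 4 / 3 + 4 / 9 * (1 + 3 * a) ^ 6 := by
    have h1 : 1 + 3 * a ≤ (1 + 3 * a) ^ 4 := le_self_pow₀ (by linarith) (by norm_num)
    have h2 : 0 ≤ (1 + 3 * a) ^ 6 := by positivity
    linarith
  obtain ⟨s, hs, h⟩ := intermediate_value_Icc (by linarith) hc ⟨by simpa using ha.le, hb⟩
  refine ⟨s, lt_of_le_of_ne hs.1 ?_, h⟩
  rintro rfl
  norm_num at h
  linarith

theorem rpow_pow_four_eq {w : ℝ} (hw : 0 ≤ w) :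
    ∃ q, 0 ≤ q ∧ w = q ^ 4 ∧ w ^ ((3 : ℝ) / 4) = q ^ 3 := by
  refine ⟨w ^ ((1 : ℝ) / 4), by positivity, ?_, ?_⟩ <;>
  · rw [← Real.rpow_natCast, ← Real.rpow_mul hw]
    norm_num

theorem two_mul_add_pow_three_le {s p q : ℝ} (hs : 0 < s)
    (h : p ^ 2 + q ^ 4 = s ^ 2 + s ^ 4) :
    2 * p + 4 / 3 * q ^ 3 ≤ 2 * s + 4 / 3 * s ^ 3 := by
  have h1 : 2 * p * s ≤ p ^ 2 + s ^ 2 := two_mul_le_add_sq p s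
  have h2 : 4 * q ^ 3 * s ≤ s ^ 4 + 3 * q ^ 4 := by
    have : 0 ≤ (q - s) ^ 2 * (2 * q ^ 2 + (q + s) ^ 2) := by positivity
    linarith
  refine le_of_mul_le_mul_right ?_ hs
  linarith

/-- Every feasible utility is at most the boundary or the interior value. -/
theorem utility_le {a k s c : ℝ} (hs : 0 < s) (hk : k = a + s ^ 2 + s ^ 4)
    (hc : 0 ≤ c) (hck : c ≤ k) :
    2 * √c + (4/3) * (max (k - c - a) 0) ^ ((3:ℝ)/4) ≤
      max (2 * √k) (2 * s + 4 / 3 * s ^ 3) := by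
  rcases le_total (k - c - a) 0 with hw | hw
  · rw [max_eq_right hw, Real.zero_rpow (by norm_num), mul_zero, add_zero]
    exact le_max_of_le_left (by gcongr)
  · rw [max_eq_left hw]
    obtain ⟨q, -, hq, hq3⟩ := rpow_pow_four_eq hw
    rw [hq3]
    refine le_max_of_le_right (two_mul_add_pow_three_le hs ?_)
    rw [Real.sq_sqrt hc, ← hq, hk]
    ring

theorem ubarEx_eq_of_le {a k : ℝ} (ha : 0 < a) (hk0 : 0 ≤ k) (hk : k ≤ a) :
    ubarEx a k = 2 * √k := by
  refine IsGreatest.csSup_eq ⟨⟨k, hk0, le_rfl, ?_⟩, ?_⟩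
  · rw [max_eq_right (by linarith), Real.zero_rpow (by norm_num)]
    ring
  · rintro v ⟨c, hc, hck, rfl⟩
    rw [max_eq_right (by linarith), Real.zero_rpow (by norm_num), mul_zero, add_zero]
    gcongr

theorem ubarEx_eq_max {a s : ℝ} (ha : 0 < a) (hs : 0 < s) :
    ubarEx a (a + s ^ 2 + s ^ 4) =
      max (2 * √(a + s ^ 2 + s ^ 4)) (2 * s + 4 / 3 * s ^ 3) := by
  refine IsGreatest.csSup_eq ⟨?_, ?_⟩
  · rcases max_choice (2 * √(a + s ^ 2 + s ^ 4)) (2 * s + 4 / 3 * s ^ 3) with h | h <;> rw [h]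
    · refine ⟨a + s ^ 2 + s ^ 4, by positivity, le_rfl, ?_⟩
      rw [max_eq_right (by linarith), Real.zero_rpow (by norm_num)]
      ring
    · refine ⟨s ^ 2, by positivity, by linarith [pow_pos hs 4], ?_⟩
      rw [show a + s ^ 2 + s ^ 4 - s ^ 2 - a = s ^ 4 by ring, max_eq_left (by positivity),
        Real.sqrt_sq hs.le, ← Real.rpow_natCast s 4, ← Real.rpow_mul hs.le,
        ← Real.rpow_natCast s 3]
      norm_num
  · rintro v ⟨c, hc, hck, rfl⟩
    exact utility_le hs rfl hc hck

/-- `Φ` has a unique zero `k₀ ∈ (a,∞)`, is negative on `(a,k₀)` and positive on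
`(k₀,∞)`; consequently `ū(k) = 2√k` for `0 ≤ k ≤ k₀` and `ū(k)` equals the interior
optimal value for `k ≥ k₀`. -/
theorem stmt_15 (a : ℝ) (ha : 0 < a) :
    ∃ k₀, a < k₀ ∧ Phi a k₀ = 0 ∧
      (∀ k, a < k → Phi a k = 0 → k = k₀) ∧
      (∀ k, a < k → k < k₀ → Phi a k < 0) ∧
      (∀ k, k₀ < k → 0 < Phi a k) ∧
      (∀ k, 0 ≤ k → k ≤ k₀ → ubarEx a k = 2 * Real.sqrt k) ∧
      (∀ k, k₀ ≤ k → ubarEx a k =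
        (4/3) * Real.sqrt (Real.sqrt (k - a + 1/4) - 1/2)
          * (Real.sqrt (k - a + 1/4) + 1)) := by
  obtain ⟨s₀, hs₀, h₀⟩ := exists_pos_critical ha
  have hneg : ∀ k, a < k → k < a + s₀ ^ 2 + s₀ ^ 4 → Phi a k < 0 := by
    intro k hak hk
    obtain ⟨s, hs, rfl⟩ := exists_eq_add_sq_add_pow_four hak
    have hlt : s < s₀ := by
      by_contra! hle
      exact hk.not_ge (by gcongr)
    exact Phi_neg hs.le (lt_of_lt_of_eq (by gcongr) h₀)
  have hak₀ : a < a + s₀ ^ 2 + s₀ ^ 4 := by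
    linarith [pow_pos hs₀ 2, pow_pos hs₀ 4]
  have hpos : ∀ k, a + s₀ ^ 2 + s₀ ^ 4 < k → 0 < Phi a k := by
    intro k hk
    obtain ⟨s, hs, rfl⟩ := exists_eq_add_sq_add_pow_four (hak₀.trans hk)
    have hlt : s₀ < s := by
      by_contra! hle
      exact hk.not_ge (by gcongr)
    exact Phi_pos hs (lt_of_eq_of_lt h₀.symm (by gcongr))
  have hzero := Phi_eq_zero hs₀.le h₀
  refine ⟨a + s₀ ^ 2 + s₀ ^ 4, hak₀, hzero, ?_, hneg, hpos, ?_, ?_⟩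
  · intro k hak hk
    rcases lt_trichotomy k (a + s₀ ^ 2 + s₀ ^ 4) with h | h | h
    · exact absurd hk (hneg k hak h).ne
    · exact h
    · exact absurd hk (hpos k h).ne'
  · intro k hk0 hk
    rcases le_or_gt k a with hka | hak
    · exact ubarEx_eq_of_le ha hk0 hka
    · have hle : Phi a k ≤ 0 := by
        rcases hk.eq_or_lt with rfl | h
        · exact hzero.le
        · exact (hneg k hak h).le
      obtain ⟨s, hs, rfl⟩ := exists_eq_add_sq_add_pow_four hak
      rw [Phi_eq hs.le] at hle
      rw [ubarEx_eq_max ha hs, max_eq_left (by linarith)]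
  · intro k hk
    have hge : 0 ≤ Phi a k := by
      rcases hk.eq_or_lt with rfl | h
      · exact hzero.ge
      · exact (hpos k h).le
    obtain ⟨s, hs, rfl⟩ := exists_eq_add_sq_add_pow_four (hak₀.trans_le hk)
    rw [Phi_eq hs.le] at hge
    rw [ubarEx_eq_max ha hs, max_eq_right (by linarith), interior_value_eq hs.le]
end

section
/- Let a > 0, set k₋ = (3a)^{1/2} and k₊ = (3a)^{1/2} + 4a, and define the affine function L(k) = (3a)^{−1/4}·k + (3a)^{1/4}. Then L(k) ≥ ū(k) for all k ≥ 0, with equality at k = k₋, where L(k₋) = ū(k₋) = 2(3a)^{1/4}, and at k = k₊, where L(k₊) = ū(k₊) = 2(3a)^{1/4} + 4a(3a)^{−1/4}. (Thus L is the affine piece of the concave envelope of ū, which connects the two strictly concave branches of ū at the tangent points k₋ and k₊.) -/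
theorem two_mul_sqrt_le_div_add {c t : ℝ} (hc : 0 ≤ c) (ht : 0 < t) :
    2 * Real.sqrt c ≤ c / t + t := by
  have h : c / t + t - 2 * Real.sqrt c = (Real.sqrt c - t) ^ 2 / t := by
    field_simp
    linear_combination -Real.sq_sqrt hc
  have : 0 ≤ (Real.sqrt c - t) ^ 2 / t := by positivity
  linarith

theorem pow_four_rpow_three_quarters {s : ℝ} (hs : 0 ≤ s) : (s ^ 4) ^ ((3 : ℝ) / 4) = s ^ 3 := by
  rw [← Real.rpow_natCast, ← Real.rpow_mul hs, ← Real.rpow_natCast]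
  norm_num

theorem four_thirds_mul_rpow_le {y t : ℝ} (hy : 0 ≤ y) (ht : 0 < t) :
    (4 / 3) * y ^ ((3 : ℝ) / 4) ≤ (y + t ^ 4 / 3) / t := by
  obtain ⟨s, hs, rfl⟩ : ∃ s : ℝ, 0 ≤ s ∧ y = s ^ 4 :=
    ⟨y ^ ((1 : ℝ) / 4), by positivity, by
      rw [← Real.rpow_natCast, ← Real.rpow_mul hy]
      norm_num⟩
  rw [pow_four_rpow_three_quarters hs, le_div_iff₀ ht]
  nlinarith [mul_nonneg (sq_nonneg (s - t))
    (by positivity : 0 ≤ 3 * s ^ 2 + 2 * s * t + t ^ 2)]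

theorem utility_le_affine {a t c k : ℝ} (ht : 0 < t) (hta : t ^ 4 = 3 * a)
    (hc : 0 ≤ c) (hck : c ≤ k) :
    2 * Real.sqrt c + (4 / 3) * (max (k - c - a) 0) ^ ((3 : ℝ) / 4) ≤ k / t + t := by
  have hsqrt := two_mul_sqrt_le_div_add hc ht
  rcases le_total (k - c - a) 0 with h | h
  · rw [max_eq_right h, Real.zero_rpow (by norm_num)]
    have : c / t ≤ k / t := by gcongr
    linarith
  · rw [max_eq_left h]
    have hpow := four_thirds_mul_rpow_le h ht
    have : (k - c - a + t ^ 4 / 3) / t = k / t - c / t := by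
      rw [hta]
      ring
    linarith

theorem ubarEx_le_affine {a t k : ℝ} (ht : 0 < t) (hta : t ^ 4 = 3 * a) (hk : 0 ≤ k) :
    ubarEx a k ≤ k / t + t := by
  refine csSup_le ⟨_, 0, le_rfl, hk, rfl⟩ ?_
  rintro _ ⟨c, hc, hck, rfl⟩
  exact utility_le_affine ht hta hc hck

theorem ubarEx_eq_affine {a t c k : ℝ} (ht : 0 < t) (hta : t ^ 4 = 3 * a)
    (hc : 0 ≤ c) (hck : c ≤ k)
    (h : 2 * Real.sqrt c + (4 / 3) * (max (k - c - a) 0) ^ ((3 : ℝ) / 4) = k / t + t) :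
    ubarEx a k = k / t + t := by
  refine IsGreatest.csSup_eq ⟨⟨c, hc, hck, h.symm⟩, ?_⟩
  rintro _ ⟨d, hd, hdk, rfl⟩
  exact utility_le_affine ht hta hd hdk

/-- The affine function `L(k) = (3a)^(-1/4) k + (3a)^(1/4)` dominates `ū` on `[0,∞)`,
touching it exactly at the tangent points `k₋ = (3a)^(1/2)` (where both equal
`2(3a)^(1/4)`) and `k₊ = (3a)^(1/2) + 4a` (where both equal
`2(3a)^(1/4) + 4a(3a)^(-1/4)`): it is the affine piece of the concave envelope of `ū`. -/
theorem stmt_16 (a : ℝ) (ha : 0 < a) :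
    let kminus := (3 * a) ^ ((1:ℝ)/2)
    let kplus := (3 * a) ^ ((1:ℝ)/2) + 4 * a
    let L : ℝ → ℝ := fun k => (3 * a) ^ (-(1:ℝ)/4) * k + (3 * a) ^ ((1:ℝ)/4)
    (∀ k ≥ (0:ℝ), ubarEx a k ≤ L k) ∧
    L kminus = ubarEx a kminus ∧
    ubarEx a kminus = 2 * (3 * a) ^ ((1:ℝ)/4) ∧
    L kplus = ubarEx a kplus ∧
    ubarEx a kplus = 2 * (3 * a) ^ ((1:ℝ)/4) + 4 * a * (3 * a) ^ (-(1:ℝ)/4) := by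
  have h3a : (0 : ℝ) ≤ 3 * a := by positivity
  intro kminus kplus L
  obtain ⟨t, ht_def⟩ : ∃ t, t = (3 * a) ^ ((1 : ℝ) / 4) := ⟨_, rfl⟩
  have ht : 0 < t := by rw [ht_def]; positivity
  have hta : t ^ 4 = 3 * a := by
    rw [ht_def, ← Real.rpow_natCast, ← Real.rpow_mul h3a]
    norm_num
  have hinv : (3 * a) ^ (-(1 : ℝ) / 4) = t⁻¹ := by
    rw [ht_def, ← Real.rpow_neg h3a, neg_div]
  have hsq : (3 * a) ^ ((1 : ℝ) / 2) = t ^ 2 := by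
    rw [ht_def, ← Real.rpow_natCast, ← Real.rpow_mul h3a]
    norm_num
  have hL : ∀ k, L k = k / t + t := fun k => by
    simp only [L, hinv, ← ht_def]
    ring
  have hminus : ubarEx a kminus = kminus / t + t := by
    refine ubarEx_eq_affine ht hta (sq_nonneg t) hsq.ge ?_
    simp only [kminus, hsq]
    rw [max_eq_right (by linarith), Real.zero_rpow (by norm_num), Real.sqrt_sq ht.le]
    field_simp
    ring
  have hplus : ubarEx a kplus = kplus / t + t := by
    refine ubarEx_eq_affine ht hta (sq_nonneg t) (by simp only [kplus, hsq]; linarith) ?_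
    simp only [kplus, hsq]
    rw [show t ^ 2 + 4 * a - t ^ 2 - a = t ^ 4 by linarith, max_eq_left (by positivity),
      pow_four_rpow_three_quarters ht.le, Real.sqrt_sq ht.le]
    field_simp
    linear_combination 4 * hta
  refine ⟨fun k hk => (hL k).symm ▸ ubarEx_le_affine ht hta hk, (hL _).trans hminus.symm, ?_,
    (hL _).trans hplus.symm, ?_⟩
  · rw [hminus, ← ht_def]
    simp only [kminus, hsq]
    field_simp
    ring
  · rw [hplus, ← ht_def, hinv]
    simp only [kplus, hsq]
    field_simp
    ring
end

section
/- Let a > 0 and y > 0. Then sup_{c ≥ 0} ( 2c^{1/2} − c y ) = 1/y, and sup_{g ≥ 0} ( (4/3)((g−a)⁺)^{3/4} − g y ) = max( 0, (1/3)y^{−3} − a y ). Consequently the dual utility h(y) = sup_{c ≥ 0, g ≥ 0} ( 2c^{1/2} + (4/3)((g−a)⁺)^{3/4} − (c+g) y ) satisfies h(y) = y^{−1} + (1/3)y^{−3} − a y for 0 < y < (3a)^{−1/4} and h(y) = y^{−1} for y ≥ (3a)^{−1/4}; in particular h is continuous, but not differentiable at y = (3a)^{−1/4}. -/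
/-- The dual utility `h(y) = sup_{c,g ≥ 0} (2√c + (4/3)((g-a)⁺)^(3/4) - (c+g)y)`. -/
noncomputable def hdualEx (a y : ℝ) : ℝ :=
  sSup {v | ∃ c g : ℝ, 0 ≤ c ∧ 0 ≤ g ∧
    v = 2 * Real.sqrt c + (4/3) * (max (g - a) 0) ^ ((3:ℝ)/4) - (c + g) * y}

/-- The concave conjugate of `c ↦ 2√c` at `y` is `1 / y`, attained at `c = y⁻²`. -/
theorem isGreatest_conjugate_sqrt {y : ℝ} (hy : 0 < y) :
    IsGreatest {v | ∃ c, 0 ≤ c ∧ v = 2 * Real.sqrt c - c * y} (1 / y) := by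
  constructor
  · refine ⟨(1 / y) ^ 2, by positivity, ?_⟩
    rw [Real.sqrt_sq (by positivity)]
    field_simp
    ring
  · rintro v ⟨c, hc, rfl⟩
    obtain ⟨s, hs⟩ : ∃ s, s = Real.sqrt c := ⟨_, rfl⟩
    have hcs : c = s ^ 2 := by rw [hs, Real.sq_sqrt hc]
    rw [← hs, hcs, le_div_iff₀ hy]
    nlinarith [sq_nonneg (s * y - 1)]

theorem pow_four_rpow_three_quarters_s17 {t : ℝ} (ht : 0 ≤ t) :
    (t ^ 4) ^ ((3 : ℝ) / 4) = t ^ 3 := by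
  rw [← Real.rpow_natCast t 4, ← Real.rpow_mul ht, ← Real.rpow_natCast t 3]
  norm_num

theorem rpow_neg_three {y : ℝ} (hy : 0 < y) : y ^ (-(3 : ℝ)) = (y ^ 3)⁻¹ := by
  rw [Real.rpow_neg hy.le]
  norm_cast

/-- The concave conjugate of the luxury utility `g ↦ (4/3) ((g - a)⁺) ^ (3/4)`. -/
theorem isGreatest_conjugate_luxury {a y : ℝ} (ha : 0 < a) (hy : 0 < y) :
    IsGreatest {v | ∃ g, 0 ≤ g ∧ v = (4/3) * (max (g - a) 0) ^ ((3:ℝ)/4) - g * y}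
      (max 0 ((1/3) * y ^ (-(3:ℝ)) - a * y)) := by
  rw [rpow_neg_three hy]
  constructor
  · rcases le_total ((1/3) * (y ^ 3)⁻¹ - a * y) 0 with h | h
    · rw [max_eq_left h]
      refine ⟨0, le_rfl, ?_⟩
      rw [max_eq_right (by linarith), Real.zero_rpow (by norm_num)]
      ring
    · rw [max_eq_right h]
      refine ⟨a + y⁻¹ ^ 4, by positivity, ?_⟩
      rw [add_sub_cancel_left, max_eq_left (by positivity),
        pow_four_rpow_three_quarters_s17 (by positivity)]
      field_simp
      ring
  · rintro v ⟨g, hg, rfl⟩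
    rcases le_total (g - a) 0 with h | h
    · rw [max_eq_right h, Real.zero_rpow (by norm_num)]
      exact le_max_of_le_left (by nlinarith [mul_nonneg hg hy.le])
    · refine le_max_of_le_right ?_
      rw [max_eq_left h]
      obtain ⟨t, ht, hgt⟩ : ∃ t : ℝ, 0 ≤ t ∧ g - a = t ^ 4 := by
        refine ⟨(g - a) ^ ((1 : ℝ) / 4), by positivity, ?_⟩
        rw [← Real.rpow_natCast, ← Real.rpow_mul h]
        norm_num
      rw [hgt, pow_four_rpow_three_quarters_s17 ht, show g = a + t ^ 4 by linarith]
      have key : 4 * t ^ 3 - 3 * t ^ 4 * y ≤ (y ^ 3)⁻¹ := by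
        rw [← one_div, le_div_iff₀ (by positivity)]
        have : 0 ≤ (t * y - 1) ^ 2 * (3 * (t * y) ^ 2 + 2 * (t * y) + 1) := by positivity
        nlinarith
      linarith

/-- The dual utility separates into the conjugates of its two summands. -/
theorem hdualEx_eq {a y : ℝ} (ha : 0 < a) (hy : 0 < y) :
    hdualEx a y = y⁻¹ + max 0 ((1/3) * (y ^ 3)⁻¹ - a * y) := by
  have hC := isGreatest_conjugate_sqrt hy
  have hG := isGreatest_conjugate_luxury ha hy
  rw [rpow_neg_three hy] at hG
  refine IsGreatest.csSup_eq ⟨?_, ?_⟩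
  · obtain ⟨c, hc, hcv⟩ := hC.1
    obtain ⟨g, hg, hgv⟩ := hG.1
    refine ⟨c, g, hc, hg, ?_⟩
    rw [hgv, ← one_div, hcv]
    ring
  · rintro v ⟨c, g, hc, hg, rfl⟩
    have h₁ := hC.2 ⟨c, hc, rfl⟩
    have h₂ := hG.2 ⟨g, hg, rfl⟩
    rw [one_div] at h₁
    linarith

theorem luxury_nonneg_iff {a y : ℝ} (hy : 0 < y) :
    0 ≤ (1/3) * (y ^ 3)⁻¹ - a * y ↔ 3 * a * y ^ 4 ≤ 1 := by
  have h : (1/3) * (y ^ 3)⁻¹ - a * y = (1 - 3 * a * y ^ 4) / (3 * y ^ 3) := by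
    field_simp
  rw [h, le_div_iff₀ (by positivity), zero_mul, sub_nonneg]

theorem luxury_nonpos_iff {a y : ℝ} (hy : 0 < y) :
    (1/3) * (y ^ 3)⁻¹ - a * y ≤ 0 ↔ 1 ≤ 3 * a * y ^ 4 := by
  have h : (1/3) * (y ^ 3)⁻¹ - a * y = (1 - 3 * a * y ^ 4) / (3 * y ^ 3) := by
    field_simp
  rw [h, div_le_iff₀ (by positivity), zero_mul, sub_nonpos]

theorem three_mul_threshold_pow_four {a : ℝ} (ha : 0 < a) :
    3 * a * ((3 * a) ^ (-(1:ℝ)/4)) ^ 4 = 1 := by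
  have h : (0 : ℝ) < 3 * a := by positivity
  rw [← Real.rpow_natCast, ← Real.rpow_mul h.le]
  norm_num [Real.rpow_neg_one]
  field_simp

theorem luxury_nonneg_of_le_threshold {a y : ℝ} (ha : 0 < a) (hy : 0 < y)
    (h : y ≤ (3 * a) ^ (-(1:ℝ)/4)) : 0 ≤ (1/3) * (y ^ 3)⁻¹ - a * y := by
  rw [luxury_nonneg_iff hy, ← three_mul_threshold_pow_four ha]
  gcongr

theorem luxury_nonpos_of_threshold_le {a y : ℝ} (ha : 0 < a)
    (h : (3 * a) ^ (-(1:ℝ)/4) ≤ y) : (1/3) * (y ^ 3)⁻¹ - a * y ≤ 0 := by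
  have hy : 0 < y := lt_of_lt_of_le (by positivity) h
  rw [luxury_nonpos_iff hy, ← three_mul_threshold_pow_four ha]
  gcongr

theorem continuousOn_hdualEx {a : ℝ} (ha : 0 < a) :
    ContinuousOn (hdualEx a) (Set.Ioi 0) := by
  have h : ContinuousOn (fun y : ℝ => y⁻¹ + max 0 ((1/3) * (y ^ 3)⁻¹ - a * y)) (Set.Ioi 0) := by
    have h₁ : ContinuousOn (fun y : ℝ => y⁻¹) (Set.Ioi 0) :=
      continuousOn_id.inv₀ fun y hy => (ne_of_gt hy : y ≠ 0)
    have h₃ : ContinuousOn (fun y : ℝ => (y ^ 3)⁻¹) (Set.Ioi 0) :=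
      (continuousOn_id.pow 3).inv₀ fun y hy => pow_ne_zero 3 (ne_of_gt hy : y ≠ 0)
    fun_prop
  exact h.congr fun y hy => hdualEx_eq ha hy

/-- At the threshold the luxury part `h(y) - y⁻¹` has a minimum, so its derivative would have to
vanish there, while its left derivative is negative. -/
theorem not_differentiableAt_hdualEx {a : ℝ} (ha : 0 < a) :
    ¬ DifferentiableAt ℝ (hdualEx a) ((3 * a) ^ (-(1:ℝ)/4)) := by
  intro hd
  have hp : 0 < (3 * a) ^ (-(1:ℝ)/4) := by positivity
  have hle := fun y hy => luxury_nonneg_of_le_threshold (y := y) ha hy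
  have hzero := le_antisymm (luxury_nonpos_of_threshold_le ha le_rfl) (hle _ hp le_rfl)
  generalize (3 * a) ^ (-(1:ℝ)/4) = p at hd hp hle hzero
  have hsub : ∀ y, 0 < y → hdualEx a y - y⁻¹ = max 0 ((1/3) * (y ^ 3)⁻¹ - a * y) := by
    intro y hy
    rw [hdualEx_eq ha hy, add_sub_cancel_left]
  have hD : DifferentiableAt ℝ (fun y => hdualEx a y - y⁻¹) p :=
    hd.sub (differentiableAt_inv hp.ne')
  have hmin : IsLocalMin (fun y => hdualEx a y - y⁻¹) p := by
    filter_upwards [lt_mem_nhds hp] with y hy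
    rw [hsub y hy, hsub p hp, hzero, max_self]
    exact le_max_left _ _
  have hleft : HasDerivWithinAt (fun y => hdualEx a y - y⁻¹) 0 (Set.Iic p) p := by
    have := hD.hasDerivAt
    rw [hmin.deriv_eq_zero] at this
    exact this.hasDerivWithinAt
  have hformula : HasDerivWithinAt (fun y : ℝ => (1/3) * (y ^ 3)⁻¹ - a * y)
      ((1/3) * (-(3 * p ^ 2) / (p ^ 3) ^ 2) - a) (Set.Iic p) p := by
    have h₁ := (((hasDerivAt_pow 3 p).inv (pow_ne_zero 3 hp.ne')).const_mul (1/3 : ℝ)).sub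
      ((hasDerivAt_id p).const_mul a)
    refine HasDerivAt.hasDerivWithinAt ?_
    refine HasDerivAt.congr_deriv (f := fun y : ℝ => (1/3) * (y ^ 3)⁻¹ - a * y) h₁ ?_
    norm_num
  have hcongr : HasDerivWithinAt (fun y : ℝ => (1/3) * (y ^ 3)⁻¹ - a * y) 0 (Set.Iic p) p := by
    refine hleft.congr_of_eventuallyEq ?_ ?_
    · filter_upwards [self_mem_nhdsWithin, mem_nhdsWithin_of_mem_nhds (lt_mem_nhds hp)]
        with y hyp hy
      rw [hsub y hy, max_eq_right (hle y hy hyp)]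
    · rw [hsub p hp, max_eq_right (hle p hp le_rfl)]
  have heq := (uniqueDiffOn_Iic p p Set.self_mem_Iic).eq_deriv _ hformula hcongr
  have hneg : 0 < 3 * p ^ 2 / (p ^ 3) ^ 2 := by positivity
  rw [neg_div] at heq
  linarith


/-- For the utility `u(c,g) = 2√c + (4/3)((g-a)⁺)^(3/4)`:
`sup_{c ≥ 0}(2√c - cy) = 1/y`,
`sup_{g ≥ 0}((4/3)((g-a)⁺)^(3/4) - gy) = max(0, (1/3)y⁻³ - ay)`;
consequently `h(y) = y⁻¹ + (1/3)y⁻³ - ay` for `0 < y < (3a)^(-1/4)` and `h(y) = y⁻¹`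
for `y ≥ (3a)^(-1/4)`; `h` is continuous on `(0,∞)` but not differentiable at
`(3a)^(-1/4)`. -/
theorem stmt_17 (a : ℝ) (ha : 0 < a) :
    (∀ y > (0:ℝ), sSup {v | ∃ c, 0 ≤ c ∧ v = 2 * Real.sqrt c - c * y} = 1 / y) ∧
    (∀ y > (0:ℝ),
      sSup {v | ∃ g, 0 ≤ g ∧ v = (4/3) * (max (g - a) 0) ^ ((3:ℝ)/4) - g * y}
        = max 0 ((1/3) * y ^ (-(3:ℝ)) - a * y)) ∧
    (∀ y, 0 < y → y < (3 * a) ^ (-(1:ℝ)/4) →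
      hdualEx a y = y⁻¹ + (1/3) * y ^ (-(3:ℝ)) - a * y) ∧
    (∀ y, (3 * a) ^ (-(1:ℝ)/4) ≤ y → hdualEx a y = y⁻¹) ∧
    ContinuousOn (hdualEx a) (Set.Ioi 0) ∧
    ¬ DifferentiableAt ℝ (hdualEx a) ((3 * a) ^ (-(1:ℝ)/4)) := by
  refine ⟨fun y hy => (isGreatest_conjugate_sqrt hy).csSup_eq,
    fun y hy => (isGreatest_conjugate_luxury ha hy).csSup_eq, fun y hy h => ?_, fun y h => ?_,
    continuousOn_hdualEx ha, not_differentiableAt_hdualEx ha⟩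
  · rw [hdualEx_eq ha hy, rpow_neg_three hy,
      max_eq_right (luxury_nonneg_of_le_threshold ha hy h.le)]
    ring
  · have hy : 0 < y := lt_of_lt_of_le (by positivity) h
    rw [hdualEx_eq ha hy, max_eq_left (luxury_nonpos_of_threshold_le ha h), add_zero]
end
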